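/- Let N be an indecomposable τ-rigid module in mod A. Then there exists a brick S in mod A satisfying Fac N = ⟨S⟩_tors, this brick S is unique up to isomorphism, and S is left finite. -/

import Mathlib

/-! Common definitions: finite-dimensional modules over a finite-dimensional algebra,
quotient modules, dimension vectors via composition series, Newton polytopes,
torsion classes, `Fac`, τ-rigidity, bricks, etc. -/

variable (A : Type) [Ring A]

/-- `X` is a quotient module of `M`. -/
def IsQuotientOf (M X : ModuleCat.{0} A) : Prop :=
  ∃ f : M →ₗ[A] X, Function.Surjective f

open Classical in
/-- The dimension vector of a module `M`, relative to a family `S : Fin n → ModuleCat A`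
of (representatives of the isomorphism classes of the) simple `A`-modules: its `i`-th entry
is the multiplicity of `S i` as a composition factor of `M` (well defined by Jordan–Hölder,
for `M` of finite length). -/
noncomputable def dimVec {n : ℕ} (S : Fin n → ModuleCat.{0} A)
    (M : Type) [AddCommGroup M] [Module A M] : Fin n → ℕ := fun i =>
  if h : ∃ s : CompositionSeries (Submodule A M),
      RelSeries.head s = ⊥ ∧ RelSeries.last s = ⊤ then
    Nat.card {j : Fin h.choose.length //
      Nonempty ((↥(h.choose j.succ) ⧸
        (Submodule.comap (h.choose j.succ).subtype
          (h.choose j.castSucc))) ≃ₗ[A] S i)}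
  else 0

/-- The Newton polytope of `U`: the convex hull in `ℝⁿ` of the dimension vectors of
the quotient modules of `U`. -/
noncomputable def newtonPolytope {n : ℕ} (S : Fin n → ModuleCat.{0} A)
    (U : ModuleCat.{0} A) : Set (Fin n → ℝ) :=
  convexHull ℝ { v : Fin n → ℝ | ∃ p : Submodule A U,
    v = fun i => ((dimVec A S (↥U ⧸ p) i : ℕ) : ℝ) }

/-- `Fac M`: the class of quotient modules of finite direct sums of copies of `M`. -/
def Fac (M : ModuleCat.{0} A) : Set (ModuleCat.{0} A) :=
  { X | ∃ (k : ℕ) (f : (Fin k → M) →ₗ[A] X), Function.Surjective f }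

/-- A torsion class in `mod A`: a class of finite-dimensional `A`-modules closed under
isomorphisms, quotient modules and extensions. -/
def IsTorsionClass (T : Set (ModuleCat.{0} A)) : Prop :=
  (∀ M ∈ T, Module.Finite A M) ∧
  (∀ M ∈ T, ∀ N : ModuleCat.{0} A, Nonempty (M ≃ₗ[A] N) → N ∈ T) ∧
  (∀ M ∈ T, ∀ X : ModuleCat.{0} A, IsQuotientOf A M X → X ∈ T) ∧
  (∀ (L E N : ModuleCat.{0} A) (f : L →ₗ[A] E) (g : E →ₗ[A] N),
    Function.Injective f → Function.Surjective g →
    LinearMap.range f = LinearMap.ker g → L ∈ T → N ∈ T → E ∈ T)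

/-- `⟨N⟩_tors`, the smallest torsion class containing `N`. -/
def torsGen (N : ModuleCat.{0} A) : Set (ModuleCat.{0} A) :=
  ⋂₀ { T | IsTorsionClass A T ∧ N ∈ T }

/-- A module `N` is left finite if the torsion class it generates is functorially finite,
i.e. `⟨N⟩_tors = Fac M` for some `M` in `mod A`. -/
def LeftFinite (N : ModuleCat.{0} A) : Prop :=
  ∃ M : ModuleCat.{0} A, Module.Finite A M ∧ torsGen A N = Fac A M

/-- `M` is τ-rigid: `Ext¹(M, X) = 0` for every `X ∈ Fac M`, expressed by the splitting of
every short exact sequence `0 → X → E → M → 0`. -/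
def IsTauRigid (M : ModuleCat.{0} A) : Prop :=
  ∀ X ∈ Fac A M, ∀ (E : ModuleCat.{0} A) (f : X →ₗ[A] E) (g : E →ₗ[A] M),
    Function.Injective f → Function.Surjective g → LinearMap.range f = LinearMap.ker g →
    ∃ s : M →ₗ[A] E, g.comp s = LinearMap.id

/-- `M` is indecomposable. -/
def Indecomposable (M : ModuleCat.{0} A) : Prop :=
  Nontrivial M ∧ ∀ (M₁ M₂ : ModuleCat.{0} A),
    Nonempty (M ≃ₗ[A] (M₁ × M₂)) → (Subsingleton M₁ ∨ Subsingleton M₂)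

/-- `M` is a brick: its endomorphism ring is a division ring, i.e. `M ≠ 0` and every
nonzero endomorphism of `M` is invertible. -/
def IsBrick (M : ModuleCat.{0} A) : Prop :=
  Nontrivial M ∧ ∀ f : M →ₗ[A] M, f ≠ 0 → Function.Bijective f

section

variable {A}

theorem IsTorsionClass.of_subsingleton {T : Set (ModuleCat.{0} A)} (hT : IsTorsionClass A T)
    {X : ModuleCat.{0} A} (hX : X ∈ T) (M : ModuleCat.{0} A) [Subsingleton M] : M ∈ T :=
  hT.2.2.1 X hX M ⟨0, fun _ => ⟨0, Subsingleton.elim _ _⟩⟩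

/-- A noetherian module has a submodule in a nonempty torsion class `T` such that the
corresponding quotient receives no nonzero map from a module in `T`. -/
theorem IsTorsionClass.exists_submodule {T : Set (ModuleCat.{0} A)} (hT : IsTorsionClass A T)
    {X₀ : ModuleCat.{0} A} (hX₀ : X₀ ∈ T) (M : Type) [AddCommGroup M] [Module A M]
    [IsNoetherian A M] :
    ∃ P : Submodule A M, ModuleCat.of A P ∈ T ∧
      ∀ X ∈ T, ∀ h : X →ₗ[A] M ⧸ P, h = 0 := by
  obtain ⟨P, hP, hmax⟩ := set_has_maximal_iff_noetherian.mpr ‹IsNoetherian A M›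
    {P : Submodule A M | ModuleCat.of A P ∈ T}
    ⟨⊥, hT.of_subsingleton hX₀ (ModuleCat.of A (⊥ : Submodule A M))⟩
  refine ⟨P, hP, fun X hX h => ?_⟩
  let Q : Submodule A M := (LinearMap.range h).comap P.mkQ
  have hPQ : P ≤ Q := fun x hx => ⟨0, by simp [(Submodule.Quotient.mk_eq_zero P).mpr hx]⟩
  let g : Q →ₗ[A] LinearMap.range h := P.mkQ.restrict fun _ hx => hx
  have hg : Function.Surjective g := by
    rintro ⟨y, hy⟩
    obtain ⟨x, rfl⟩ := P.mkQ_surjective y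
    exact ⟨⟨x, hy⟩, rfl⟩
  have hQ : ModuleCat.of A Q ∈ T := by
    refine hT.2.2.2 (ModuleCat.of A P) (ModuleCat.of A Q) (ModuleCat.of A (LinearMap.range h))
      (Submodule.inclusion hPQ) g (Submodule.inclusion_injective hPQ) hg ?_ hP
      (hT.2.2.1 X hX _ ⟨h.rangeRestrict, h.surjective_rangeRestrict⟩)
    ext ⟨x, hx⟩
    rw [Submodule.range_inclusion]
    simp [g, Subtype.ext_iff, LinearMap.restrict_apply]
  have hQP : Q ≤ P := by
    by_contra hne
    exact hmax Q hQ (lt_of_le_not_ge hPQ hne)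
  ext x
  obtain ⟨y, hy⟩ := P.mkQ_surjective (h x)
  have : y ∈ Q := ⟨x, hy.symm⟩
  simpa [← hy] using hQP this

/-- A noetherian module generated by images of modules in a torsion class belongs to it. -/
theorem IsTorsionClass.mem_of_forall {T : Set (ModuleCat.{0} A)} (hT : IsTorsionClass A T)
    {X₀ : ModuleCat.{0} A} (hX₀ : X₀ ∈ T) (M : ModuleCat.{0} A) [IsNoetherian A M]
    (hM : ∀ P : Submodule A M, (∀ X ∈ T, ∀ h : X →ₗ[A] M ⧸ P, h = 0) → P = ⊤) : M ∈ T := by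
  obtain ⟨P, hP, h⟩ := hT.exists_submodule hX₀ M
  obtain rfl := hM P h
  exact hT.2.1 _ hP M ⟨Submodule.topEquiv⟩

theorem mem_Fac_self (N : ModuleCat.{0} A) : N ∈ Fac A N :=
  ⟨1, LinearMap.proj 0, LinearMap.proj_surjective 0⟩

theorem finite_of_mem_Fac {N X : ModuleCat.{0} A} [Module.Finite A N] (hX : X ∈ Fac A N) :
    Module.Finite A X := by
  obtain ⟨k, f, hf⟩ := hX
  exact Module.Finite.of_surjective f hf

theorem mem_Fac_of_surjective {N X Y : ModuleCat.{0} A} (hX : X ∈ Fac A N) (g : X →ₗ[A] Y)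
    (hg : Function.Surjective g) : Y ∈ Fac A N := by
  obtain ⟨k, f, hf⟩ := hX
  exact ⟨k, g.comp f, hg.comp hf⟩

/-- Every map from a `τ`-rigid module `N` lifts along a surjection with kernel in `Fac N`. -/
theorem IsTauRigid.exists_lift {N : ModuleCat.{0} A} (hN : IsTauRigid A N)
    {L E X : ModuleCat.{0} A} (f : L →ₗ[A] E) (g : E →ₗ[A] X) (hf : Function.Injective f)
    (hg : Function.Surjective g) (hfg : LinearMap.range f = LinearMap.ker g)
    (hL : L ∈ Fac A N) (h : N →ₗ[A] X) : ∃ h' : N →ₗ[A] E, g.comp h' = h := by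
  have hgf (x : L) : g (f x) = 0 := by
    rw [← LinearMap.mem_ker, ← hfg]; exact ⟨x, rfl⟩
  let P : Submodule A (E × N) :=
    LinearMap.eqLocus (g.comp (LinearMap.fst A E N)) (h.comp (LinearMap.snd A E N))
  let i : L →ₗ[A] P := LinearMap.codRestrict P (f.prod 0) fun x => by
    simp [P, LinearMap.mem_eqLocus, hgf]
  let p : P →ₗ[A] N := (LinearMap.snd A E N).comp P.subtype
  have hP (x : P) : g x.1.1 = h x.1.2 := x.2
  obtain ⟨s, hs⟩ := hN L hL (ModuleCat.of A P) i p
    (fun x y hxy => hf (congrArg (fun z : P => z.1.1) hxy))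
    (fun n => by
      obtain ⟨e, he⟩ := hg (h n)
      exact ⟨⟨(e, n), he⟩, rfl⟩)
    (by
      ext x
      constructor
      · rintro ⟨y, rfl⟩
        rfl
      · intro hx
        have hx2 : x.1.2 = 0 := hx
        have h1 : x.1.1 ∈ LinearMap.range f := by
          rw [hfg, LinearMap.mem_ker, hP x, hx2, map_zero]
        obtain ⟨y, hy⟩ := h1
        exact ⟨y, Subtype.ext (Prod.ext hy hx2.symm)⟩)
  refine ⟨(LinearMap.fst A E N).comp (P.subtype.comp s), ?_⟩
  ext n
  have h2 : (s n : P).1.2 = n := LinearMap.congr_fun hs n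
  exact (hP (s n)).trans (congrArg h h2)

/-- `Fac N` is a torsion class when `N` is `τ`-rigid. -/
theorem IsTauRigid.isTorsionClass_Fac {N : ModuleCat.{0} A} (hN : IsTauRigid A N)
    [Module.Finite A N] : IsTorsionClass A (Fac A N) := by
  refine ⟨fun X hX => finite_of_mem_Fac hX,
    fun X hX Y ⟨e⟩ => mem_Fac_of_surjective hX e.toLinearMap e.surjective,
    fun X hX Y ⟨g, hg⟩ => mem_Fac_of_surjective hX g hg, ?_⟩
  intro L E X f g hf hg hfg hL hX
  obtain ⟨k, u, hu⟩ := id hL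
  obtain ⟨l, v, hv⟩ := hX
  choose w hw using fun i : Fin l =>
    hN.exists_lift f g hf hg hfg hL (v.comp (LinearMap.single A (fun _ => (N : Type)) i))
  let w' : (Fin l → N) →ₗ[A] E := LinearMap.lsum A (fun _ => (N : Type)) ℕ w
  have hw' (y : Fin l → N) : g (w' y) = v y := by
    have : g.comp w' = v := by
      refine LinearMap.pi_ext' fun i => ?_
      rw [← hw i]
      ext n
      simp only [w', LinearMap.comp_apply, LinearMap.lsum_apply, LinearMap.sum_apply,
        LinearMap.proj_apply, LinearMap.single_apply]
      rw [Finset.sum_eq_single i (fun j _ hj => by simp [hj]) (by simp)]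
      simp
    exact LinearMap.congr_fun this y
  let e : (Fin (k + l) → N) →ₗ[A] ((Fin k → N) × (Fin l → N)) :=
    (LinearMap.funLeft A N (Fin.castAdd l)).prod (LinearMap.funLeft A N (Fin.natAdd k))
  refine ⟨k + l, ((f.comp u).coprod w').comp e, fun x => ?_⟩
  obtain ⟨b, hb⟩ := hv (g x)
  have : x - w' b ∈ LinearMap.range f := by
    rw [hfg, LinearMap.mem_ker, map_sub, hw', hb, sub_self]
  obtain ⟨y, hy⟩ := this
  obtain ⟨a, rfl⟩ := hu y
  refine ⟨Fin.append a b, ?_⟩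
  have he : e (Fin.append a b) = (a, b) := by
    ext i <;> simp [e, LinearMap.funLeft_apply]
  simp [he, hy]

/-- A torsion class containing `N` contains `Fac N`. -/
theorem IsTorsionClass.Fac_subset [IsNoetherianRing A] {T : Set (ModuleCat.{0} A)}
    (hT : IsTorsionClass A T) {N : ModuleCat.{0} A} (hN : N ∈ T) : Fac A N ⊆ T := by
  intro X hX
  have := hT.1 N hN
  have := finite_of_mem_Fac hX
  refine hT.mem_of_forall hN X fun P hP => ?_
  obtain ⟨k, f, hf⟩ := hX
  have h0 : P.mkQ.comp f = 0 := LinearMap.pi_ext' fun i => by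
    rw [LinearMap.zero_comp]
    exact hP N hN _
  rw [eq_top_iff]
  rintro x -
  obtain ⟨y, rfl⟩ := hf x
  simpa using LinearMap.congr_fun h0 y

theorem mem_torsGen_self (N : ModuleCat.{0} A) : N ∈ torsGen A N :=
  fun _ hT => hT.2

theorem torsGen_subset {T : Set (ModuleCat.{0} A)} (hT : IsTorsionClass A T)
    {N : ModuleCat.{0} A} (hN : N ∈ T) : torsGen A N ⊆ T :=
  Set.sInter_subset_of_mem ⟨hT, hN⟩

/-- A linear map vanishing on the kernel of a surjection factors through the surjection. -/
theorem exists_comp_eq_of_ker_le {E X Y : Type} [AddCommGroup E] [AddCommGroup X]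
    [AddCommGroup Y] [Module A E] [Module A X] [Module A Y] (g : E →ₗ[A] X)
    (hg : Function.Surjective g) (h : E →ₗ[A] Y) (hgh : LinearMap.ker g ≤ LinearMap.ker h) :
    ∃ h' : X →ₗ[A] Y, h'.comp g = h := by
  refine ⟨((LinearMap.ker g).liftQ h hgh).comp
    (g.quotKerEquivOfSurjective hg).symm.toLinearMap, ?_⟩
  ext x
  have : (g.quotKerEquivOfSurjective hg).symm (g x) = (LinearMap.ker g).mkQ x := by
    rw [LinearEquiv.symm_apply_eq]
    rfl
  simp [this]

/-- The finite modules all of whose maps to `S` satisfy a predicate form a torsion class, provided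
the predicate is compatible with composition and with extensions. -/
theorem isTorsionClass_setOf_forall_hom [IsNoetherianRing A] (S : ModuleCat.{0} A)
    (p : Submodule A S → Prop) (hp : ∀ U V, p U → U ≤ V → U ≠ ⊥ → p V) :
    IsTorsionClass A
      {X | Module.Finite A X ∧ ∀ h : X →ₗ[A] S, h = 0 ∨ p (LinearMap.range h)} := by
  have hquot : ∀ M ∈ {X : ModuleCat.{0} A |
      Module.Finite A X ∧ ∀ h : X →ₗ[A] S, h = 0 ∨ p (LinearMap.range h)},
      ∀ X : ModuleCat.{0} A, IsQuotientOf A M X → X ∈ {X : ModuleCat.{0} A |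
      Module.Finite A X ∧ ∀ h : X →ₗ[A] S, h = 0 ∨ p (LinearMap.range h)} := by
    rintro M ⟨hM, hM'⟩ X ⟨g, hg⟩
    refine ⟨Module.Finite.of_surjective g hg, fun h => (hM' (h.comp g)).imp ?_ ?_⟩
    · intro h0
      rwa [← LinearMap.cancel_right hg, LinearMap.zero_comp]
    · rw [LinearMap.range_comp_of_range_eq_top _ (LinearMap.range_eq_top.mpr hg)]
      exact id
  refine ⟨fun M hM => hM.1,
    fun M hM X ⟨e⟩ => hquot M hM X ⟨e.toLinearMap, e.surjective⟩, hquot, ?_⟩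
  rintro L E X f g - hg hfg ⟨hL, hL'⟩ ⟨hX, hX'⟩
  have : Module.Finite A (LinearMap.ker g) := hfg ▸ inferInstance
  have : Module.Finite A (E ⧸ LinearMap.ker g) :=
    Module.Finite.equiv (g.quotKerEquivOfSurjective hg).symm
  refine ⟨Module.Finite.of_submodule_quotient (LinearMap.ker g), fun h => ?_⟩
  by_cases h0 : h.comp f = 0
  · obtain ⟨h', rfl⟩ := exists_comp_eq_of_ker_le g hg h (by
      rwa [← hfg, LinearMap.range_le_ker_iff])
    rw [LinearMap.range_comp_of_range_eq_top _ (LinearMap.range_eq_top.mpr hg)]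
    exact (hX' h').imp (fun hz => by rw [hz, LinearMap.zero_comp]) id
  · exact .inr (hp _ _ ((hL' _).resolve_left h0) (LinearMap.range_comp_le_range f h)
      (by rwa [Ne, LinearMap.range_eq_bot]))

/-- If `S` is a brick, every map from a module in `⟨S⟩_tors` to `S` is zero or surjective. -/
theorem IsBrick.eq_zero_or_surjective [IsNoetherianRing A] {S : ModuleCat.{0} A}
    [Module.Finite A S] (hS : IsBrick A S) {X : ModuleCat.{0} A} (hX : X ∈ torsGen A S)
    (h : X →ₗ[A] S) : h = 0 ∨ Function.Surjective h := by
  have hT := isTorsionClass_setOf_forall_hom S (· = ⊤) (by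
    rintro U V rfl hUV -
    exact top_le_iff.mp hUV)
  rw [← LinearMap.range_eq_top]
  exact (torsGen_subset hT ⟨‹_›, fun f => or_iff_not_imp_left.mpr fun hf =>
    LinearMap.range_eq_top.mpr (hS.2 f hf).2⟩ hX).2 h

/-- A nonzero module in `⟨S⟩_tors` receives a nonzero map from `S`. -/
theorem exists_ne_zero_of_mem_torsGen [IsNoetherianRing A] {S X : ModuleCat.{0} A}
    [Module.Finite A S] [Nontrivial X] (hX : X ∈ torsGen A S) :
    ∃ h : S →ₗ[A] X, h ≠ 0 := by
  by_contra! hzero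
  have hT := isTorsionClass_setOf_forall_hom X (fun _ => False) (fun _ _ h _ _ => h)
  obtain ⟨x, hx⟩ := exists_ne (0 : X)
  have hid := (torsGen_subset hT ⟨‹_›, fun h => .inl (hzero h)⟩ hX).2 LinearMap.id
  rw [or_false] at hid
  exact hx (LinearMap.congr_fun hid x)

/-- Bricks generating the same torsion class are isomorphic. -/
theorem IsBrick.nonempty_linearEquiv [IsNoetherianRing A] {S S' : ModuleCat.{0} A}
    [Module.Finite A S] [Module.Finite A S'] (hS : IsBrick A S) (hS' : IsBrick A S')
    (h : torsGen A S = torsGen A S') : Nonempty (S ≃ₗ[A] S') := by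
  have := hS.1
  have := hS'.1
  have h₁ : S ∈ torsGen A S' := h ▸ mem_torsGen_self S
  have h₂ : S' ∈ torsGen A S := h ▸ mem_torsGen_self S'
  obtain ⟨f, hf⟩ := exists_ne_zero_of_mem_torsGen h₂
  obtain ⟨g, hg⟩ := exists_ne_zero_of_mem_torsGen h₁
  have hf := (hS'.eq_zero_or_surjective h₁ f).resolve_left hf
  have hg := (hS.eq_zero_or_surjective h₂ g).resolve_left hg
  have hgf : Function.Injective (g.comp f) :=
    IsNoetherian.injective_of_surjective_endomorphism _ (hg.comp hf)
  exact ⟨LinearEquiv.ofBijective f ⟨Function.Injective.of_comp hgf, hf⟩⟩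

/-- Fitting's lemma: an endomorphism of an indecomposable module of finite length is
nilpotent or bijective. -/
theorem Indecomposable.isNilpotent_or_bijective {N : ModuleCat.{0} A} [IsNoetherian A N]
    [IsArtinian A N] (hN : Indecomposable A N) (f : Module.End A N) :
    IsNilpotent f ∨ Function.Bijective f := by
  obtain ⟨n, hn⟩ := Filter.eventually_atTop.mp
    (LinearMap.eventually_isCompl_ker_pow_range_pow f)
  have hc := hn (n + 1) n.le_succ
  rcases hN.2 (ModuleCat.of A (LinearMap.ker (f ^ (n + 1))))
    (ModuleCat.of A (LinearMap.range (f ^ (n + 1))))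
    ⟨(Submodule.prodEquivOfIsCompl _ _ hc).symm⟩ with h | h
  · right
    have hinj : Function.Injective (f ^ (n + 1)) :=
      LinearMap.ker_eq_bot.mp (Submodule.subsingleton_iff_eq_bot.mp h)
    rw [pow_succ] at hinj
    exact IsArtinian.bijective_of_injective_endomorphism f (Function.Injective.of_comp hinj)
  · left
    exact ⟨n + 1, LinearMap.range_eq_bot.mp (Submodule.subsingleton_iff_eq_bot.mp h)⟩

/-- A non-bijective endomorphism of an indecomposable module of finite length lies in the
radical of the endomorphism ring. -/
theorem Indecomposable.mem_jacobson {N : ModuleCat.{0} A} [IsNoetherian A N]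
    [IsArtinian A N] (hN : Indecomposable A N) {f : Module.End A N}
    (hf : ¬ Function.Bijective f) : f ∈ Ring.jacobson (Module.End A N) := by
  rw [← Ideal.jacobson_bot, Ideal.mem_jacobson_iff]
  intro g
  have hnil : IsNilpotent (g * f) := by
    refine (hN.isNilpotent_or_bijective (g * f)).resolve_right fun h => hf ?_
    exact IsArtinian.bijective_of_injective_endomorphism f (Function.Injective.of_comp h.1)
  obtain ⟨u, hu⟩ := hnil.isUnit_add_one
  refine ⟨(↑u⁻¹ : Module.End A N), ?_⟩
  have := u.inv_mul
  rw [hu, mul_add, mul_one, ← mul_assoc] at this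
  rw [this, sub_self]
  exact Ideal.zero_mem _

/-- The endomorphism algebra of a finite module over a finite-dimensional algebra has nilpotent
radical. -/
theorem isNilpotent_jacobson_end (K : Type) [Field K] [Algebra K A] [FiniteDimensional K A]
    (N : Type) [AddCommGroup N] [Module A N] [Module.Finite A N] :
    IsNilpotent (Ring.jacobson (Module.End A N)) := by
  let : Module K N := Module.compHom N (algebraMap K A)
  have : IsScalarTower K A N := IsScalarTower.of_algebraMap_smul fun _ _ => rfl
  have : SMulCommClass A K N := ⟨fun a k n => by
    rw [← algebraMap_smul A k n, ← algebraMap_smul A k (a • n), ← mul_smul, ← mul_smul,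
      Algebra.commutes]⟩
  have : Module.Finite K N := Module.Finite.trans A N
  have : Module.Finite K (Module.End A N) :=
    Module.Finite.of_injective (LinearMap.restrictScalarsₗ K A N N K)
      (LinearMap.restrictScalars_injective K)
  have : IsArtinianRing (Module.End A N) := IsArtinianRing.of_finite K _
  exact IsSemiprimaryRing.isNilpotent

/-- The submodule generated by the images of the radical endomorphisms. -/
def endRadical (N : ModuleCat.{0} A) : Submodule A N :=
  ⨆ f : Ring.jacobson (Module.End A N), LinearMap.range (f : Module.End A N)

theorem range_le_endRadical {N : ModuleCat.{0} A} {f : Module.End A N}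
    (hf : f ∈ Ring.jacobson (Module.End A N)) : LinearMap.range f ≤ endRadical N :=
  le_iSup (fun f : Ring.jacobson (Module.End A N) => LinearMap.range (f : Module.End A N)) ⟨f, hf⟩

/-- If the radical of `End N` is nilpotent, a submodule `P` of `N` is everything as soon as
every map from the quotient of `N` by its radical to `N ⧸ P` vanishes. -/
theorem eq_top_of_forall_endRadical {N : ModuleCat.{0} A}
    (hJ : IsNilpotent (Ring.jacobson (Module.End A N))) (P : Submodule A N)
    (hP : ∀ h : (N ⧸ endRadical N) →ₗ[A] N ⧸ P, h = 0) : P = ⊤ := by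
  obtain ⟨n, hn⟩ := hJ
  have key : ∀ f ∈ (Ring.jacobson (Module.End A N)) ^ 0, LinearMap.range f ≤ P := by
    refine Nat.decreasingInduction
      (motive := fun i _ => ∀ f ∈ (Ring.jacobson (Module.End A N)) ^ i, LinearMap.range f ≤ P)
      ?_ ?_ (Nat.zero_le n)
    · intro i _ ih f hf
      have hle : endRadical N ≤ LinearMap.ker (P.mkQ.comp f) := by
        refine iSup_le fun g => ?_
        have hfg : f * g.1 ∈ (Ring.jacobson (Module.End A N)) ^ (i + 1) := by
          rw [Submodule.pow_succ]
          exact Ideal.mul_mem_mul hf g.2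
        rintro _ ⟨x, rfl⟩
        simpa using ih _ hfg ⟨x, rfl⟩
      rintro _ ⟨x, rfl⟩
      simpa using LinearMap.congr_fun (hP ((endRadical N).liftQ _ hle)) ((endRadical N).mkQ x)
    · intro f hf
      rw [hn] at hf
      rw [show f = 0 from hf]
      simp
  have := key 1 (by rw [Submodule.pow_zero]; exact Submodule.one_le.mp le_rfl)
  rw [eq_top_iff]
  exact fun x _ => this ⟨x, rfl⟩

theorem nontrivial_quotient_endRadical {N : ModuleCat.{0} A} [Nontrivial N]
    (hJ : IsNilpotent (Ring.jacobson (Module.End A N))) : Nontrivial (N ⧸ endRadical N) := by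
  by_contra h
  rw [not_nontrivial_iff_subsingleton] at h
  exact bot_ne_top (eq_top_of_forall_endRadical hJ ⊥ fun h => by
    refine LinearMap.ext fun x => ?_
    rw [Subsingleton.elim x 0, map_zero, map_zero])

theorem IsTauRigid.endRadical_mem_Fac {N : ModuleCat.{0} A} [Module.Finite A N]
    [IsNoetherian A N] (hN : IsTauRigid A N) :
    ModuleCat.of A (endRadical N) ∈ Fac A N := by
  refine hN.isTorsionClass_Fac.mem_of_forall (mem_Fac_self N) _ fun P hP => ?_
  have hle : endRadical N ≤ P.map (endRadical N).subtype := by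
    refine iSup_le fun f => ?_
    rintro _ ⟨x, rfl⟩
    have h0 := hP N (mem_Fac_self N) (P.mkQ.comp (LinearMap.codRestrict (endRadical N) f.1
      fun x => range_le_endRadical f.2 ⟨x, rfl⟩))
    have h1 := LinearMap.congr_fun h0 x
    exact ⟨_, by simpa using h1, rfl⟩
  rw [eq_top_iff]
  rintro ⟨x, hx⟩ -
  obtain ⟨y, hy, hyx⟩ := hle hx
  exact (Subtype.ext hyx : y = ⟨x, hx⟩) ▸ hy

/-- The quotient of an indecomposable `τ`-rigid module by its radical over its endomorphism
ring is a brick. -/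
theorem IsTauRigid.isBrick_quotient_endRadical {N : ModuleCat.{0} A} [Module.Finite A N]
    [IsNoetherian A N] [IsArtinian A N] (hN : IsTauRigid A N) (hind : Indecomposable A N)
    (hJ : IsNilpotent (Ring.jacobson (Module.End A N))) :
    IsBrick A (ModuleCat.of A (N ⧸ endRadical N)) := by
  have := hind.1
  refine ⟨nontrivial_quotient_endRadical hJ, fun g hg => ?_⟩
  obtain ⟨f, hf⟩ := hN.exists_lift (L := ModuleCat.of A (endRadical N)) (E := N)
    (X := ModuleCat.of A (N ⧸ endRadical N)) (endRadical N).subtype (endRadical N).mkQ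
    (endRadical N).injective_subtype (endRadical N).mkQ_surjective (by simp)
    hN.endRadical_mem_Fac (g.comp (endRadical N).mkQ)
  have hbij : Function.Bijective f := by
    by_contra hnb
    apply hg
    have h0 : (endRadical N).mkQ.comp f = 0 := by
      rw [← LinearMap.range_le_ker_iff, Submodule.ker_mkQ]
      exact range_le_endRadical (hind.mem_jacobson hnb)
    rw [hf] at h0
    exact (LinearMap.cancel_right (endRadical N).mkQ_surjective).mp
      (h0.trans (LinearMap.zero_comp _).symm)
  have hsurj : Function.Surjective g := by
    refine Function.Surjective.of_comp (g := (endRadical N).mkQ) ?_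
    rw [← LinearMap.coe_comp, ← hf]
    exact (endRadical N).mkQ_surjective.comp hbij.2
  exact ⟨IsNoetherian.injective_of_surjective_endomorphism (M := N ⧸ endRadical N) g hsurj, hsurj⟩

/-- A `τ`-rigid module generates the same torsion class as its quotient by its radical over its
endomorphism ring. -/
theorem IsTauRigid.Fac_eq_torsGen [IsNoetherianRing A] {N : ModuleCat.{0} A} [Module.Finite A N]
    (hN : IsTauRigid A N) (hJ : IsNilpotent (Ring.jacobson (Module.End A N))) :
    Fac A N = torsGen A (ModuleCat.of A (N ⧸ endRadical N)) := by
  refine Set.Subset.antisymm ?_ (torsGen_subset hN.isTorsionClass_Fac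
    (mem_Fac_of_surjective (mem_Fac_self N) _ (endRadical N).mkQ_surjective))
  rintro X hX T ⟨hT, hST⟩
  exact hT.Fac_subset (hT.mem_of_forall hST N fun P hP =>
    eq_top_of_forall_endRadical hJ P (hP _ hST)) hX

end

/-- for an indecomposable τ-rigid module `N`, there is a brick `S` with
`Fac N = ⟨S⟩_tors`; this brick is unique up to isomorphism, and it is left finite. -/
theorem exists_unique_brick_of_indec_tauRigid (A : Type) [Ring A]
    (K : Type) [Field K] [Algebra K A] [FiniteDimensional K A]
    (N : ModuleCat.{0} A) (hN : Module.Finite A N)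
    (hNind : Indecomposable A N) (hNr : IsTauRigid A N) :
    ∃ S : ModuleCat.{0} A, Module.Finite A S ∧ IsBrick A S ∧
      Fac A N = torsGen A S ∧ LeftFinite A S ∧
      ∀ S' : ModuleCat.{0} A, Module.Finite A S' → IsBrick A S' →
        Fac A N = torsGen A S' → Nonempty (S ≃ₗ[A] S') := by
  have : IsNoetherianRing A := .of_finite K A
  have : IsArtinianRing A := .of_finite K A
  have hJ := isNilpotent_jacobson_end (A := A) K N
  have hS := hNr.isBrick_quotient_endRadical hNind hJ
  have hfac := hNr.Fac_eq_torsGen hJ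
  have hfin : Module.Finite A (ModuleCat.of A (N ⧸ endRadical N)) :=
    inferInstanceAs (Module.Finite A (N ⧸ endRadical N))
  exact ⟨_, hfin, hS, hfac, ⟨N, hN, hfac.symm⟩,
    fun S' _ hS' h => hS.nonempty_linearEquiv hS' (hfac.symm.trans h)⟩
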